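/- Let N ≥ 1 and let a be a real number with −1 < a < 1. Let K : ℝ^N × ℝ^N × (0,∞) → ℝ be a measurable kernel satisfying, for some C₀, c₀ > 0, the bound 0 ≤ K(x,y,t) ≤ C₀ t^{−N/(2−a)} exp(−c₀ (|x−y|^{(2−a)}/t)^{1/(1−a)}) for all x, y ∈ ℝ^N and t > 0. Then for all exponents 1 < q ≤ r < ∞ there exists a constant C > 0 such that for every measurable φ with ‖φ‖_{q,∞} < ∞ and every t > 0, ‖∫_{ℝ^N} K(·,y,t) φ(y) dy‖_{r,∞} ≤ C t^{−(N/(2−a))(1/q − 1/r)} ‖φ‖_{q,∞}. -/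

import Mathlib

open MeasureTheory Real Set
open scoped ENNReal

/-- The weak `L^r` quasinorm `‖f‖_{r,∞} = sup_{λ>0} λ |{|f|>λ}|^{1/r}`. -/
noncomputable def weakNorm (N : ℕ) (r : ℝ) (f : EuclideanSpace ℝ (Fin N) → ℝ) : ℝ≥0∞ :=
  ⨆ (l : ℝ) (_ : 0 < l), ENNReal.ofReal l * (volume {x : EuclideanSpace ℝ (Fin N) | l < |f x|}) ^ (1 / r)

/-- If `f` has weak-type tails of exponent `q > 1`, the part of `|f|` above height `h` is integrable,
with a quantitative bound. -/
theorem lintegral_abs_sub_le_of_meas_lt_le {α : Type*} [MeasurableSpace α] {μ : Measure α}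
    {f : α → ℝ} (hf : Measurable f) {q m h : ℝ} (hq : 1 < q) (hm : 0 < m) (hh : 0 < h)
    (hfm : ∀ l : ℝ, 0 < l → μ {x | l < |f x|} ≤ ENNReal.ofReal (m ^ q * l ^ (-q))) :
    ∫⁻ x, ENNReal.ofReal (|f x| - h) ∂μ ≤ ENNReal.ofReal (m ^ q * h ^ (1 - q) / (q - 1)) := by
  have hpos : ∀ x, ENNReal.ofReal (|f x| - h) = ENNReal.ofReal (max (|f x| - h) 0) := fun x => by
    simp [ENNReal.ofReal_max]
  simp_rw [hpos]
  rw [lintegral_eq_lintegral_meas_lt μ (f := fun x => max (|f x| - h) 0)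
    (ae_of_all _ fun x => le_max_right _ _) (by fun_prop)]
  calc ∫⁻ t in Ioi (0 : ℝ), μ {x | t < max (|f x| - h) 0}
      ≤ ∫⁻ t in Ioi (0 : ℝ), ENNReal.ofReal (m ^ q * (t + h) ^ (-q)) := by
        refine setLIntegral_mono (by fun_prop) fun t (ht : 0 < t) => ?_
        refine (measure_mono fun x (hx : t < _) => ?_).trans (hfm (t + h) (by linarith))
        rcases lt_max_iff.1 hx with hx | hx
        · exact lt_sub_iff_add_lt.1 hx
        · exact absurd hx ht.not_gt
    _ = ∫⁻ t in Ioi h, ENNReal.ofReal (m ^ q * t ^ (-q)) := by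
        have := (measurePreserving_add_right (volume : Measure ℝ) h).setLIntegral_comp_preimage_emb
          (measurableEmbedding_addRight h) (fun t => ENNReal.ofReal (m ^ q * t ^ (-q))) (Ioi h)
        simpa using this
    _ = ENNReal.ofReal (∫ t in Ioi h, m ^ q * t ^ (-q)) := by
        refine (ofReal_integral_eq_lintegral_ofReal
          ((integrableOn_Ioi_rpow_of_lt (by linarith) hh).const_mul _) ?_).symm
        filter_upwards [ae_restrict_mem measurableSet_Ioi] with t (ht : h < t)
        have := hh.trans ht
        positivity
    _ = ENNReal.ofReal (m ^ q * h ^ (1 - q) / (q - 1)) := by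
        rw [integral_const_mul, integral_Ioi_rpow_of_lt (by linarith) hh,
          show -q + 1 = -(q - 1) by ring, neg_div_neg_eq, neg_sub, mul_div_assoc]

section Kernel

variable {α : Type*} [MeasurableSpace α] {μ : Measure α} {k : α → α → ℝ≥0∞}

theorem lintegral_mul_ofReal_abs_le (hk : Measurable (Function.uncurry k)) {A : ℝ≥0∞}
    (hA : ∀ x, ∫⁻ y, k x y ∂μ ≤ A) {f : α → ℝ} (h : ℝ) (x : α) :
    ∫⁻ y, k x y * ENNReal.ofReal |f y| ∂μ ≤
      A * ENNReal.ofReal h + ∫⁻ y, k x y * ENNReal.ofReal (|f y| - h) ∂μ := by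
  have hkx : Measurable (k x) := hk.of_uncurry_left
  calc ∫⁻ y, k x y * ENNReal.ofReal |f y| ∂μ
      ≤ ∫⁻ y, (k x y * ENNReal.ofReal h + k x y * ENNReal.ofReal (|f y| - h)) ∂μ := by
        gcongr with y
        rw [← mul_add]
        gcongr
        simpa using ENNReal.ofReal_add_le (p := h) (q := |f y| - h)
    _ = (∫⁻ y, k x y ∂μ) * ENNReal.ofReal h + ∫⁻ y, k x y * ENNReal.ofReal (|f y| - h) ∂μ := by
        rw [lintegral_add_left (by fun_prop), lintegral_mul_const _ hkx]
    _ ≤ _ := by gcongr; exact hA x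

/-- Pointwise bound for the potential of a function with weak-type tails. -/
theorem lintegral_mul_ofReal_abs_le_of_meas_lt_le (hk : Measurable (Function.uncurry k)) {A B : ℝ}
    (hA0 : 0 < A) (hB0 : 0 < B) (hA : ∀ x, ∫⁻ y, k x y ∂μ ≤ ENNReal.ofReal A)
    (hB : ∀ x y, k x y ≤ ENNReal.ofReal B) {f : α → ℝ} (hf : Measurable f) {q m h : ℝ}
    (hq : 1 < q) (hm : 0 < m) (hh : 0 < h)
    (hfm : ∀ l : ℝ, 0 < l → μ {x | l < |f x|} ≤ ENNReal.ofReal (m ^ q * l ^ (-q))) (x : α) :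
    ∫⁻ y, k x y * ENNReal.ofReal |f y| ∂μ ≤
      ENNReal.ofReal (A * h + B * (m ^ q * h ^ (1 - q) / (q - 1))) := by
  have hq' : 0 < q - 1 := by linarith
  refine (lintegral_mul_ofReal_abs_le hk hA h x).trans ?_
  rw [ENNReal.ofReal_add (by positivity) (by positivity), ENNReal.ofReal_mul hA0.le,
    ENNReal.ofReal_mul hB0.le]
  gcongr
  calc ∫⁻ y, k x y * ENNReal.ofReal (|f y| - h) ∂μ
      ≤ ∫⁻ y, ENNReal.ofReal B * ENNReal.ofReal (|f y| - h) ∂μ := by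
        gcongr with y
        exact hB x y
    _ = ENNReal.ofReal B * ∫⁻ y, ENNReal.ofReal (|f y| - h) ∂μ :=
        lintegral_const_mul _ (by fun_prop)
    _ ≤ _ := by gcongr; exact lintegral_abs_sub_le_of_meas_lt_le hf hq hm hh hfm

/-- Weak type `(q, q)` bound for the potential of a function with weak-type tails. -/
theorem meas_lt_lintegral_mul_ofReal_abs_le [SFinite μ] (hk : Measurable (Function.uncurry k))
    {A : ℝ} (hA0 : 0 < A) (hA : ∀ x, ∫⁻ y, k x y ∂μ ≤ ENNReal.ofReal A)
    (hA' : ∀ y, ∫⁻ x, k x y ∂μ ≤ ENNReal.ofReal A) {f : α → ℝ} (hf : Measurable f) {q m l : ℝ}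
    (hq : 1 < q) (hm : 0 < m) (hl : 0 < l)
    (hfm : ∀ l : ℝ, 0 < l → μ {x | l < |f x|} ≤ ENNReal.ofReal (m ^ q * l ^ (-q))) :
    μ {x | ENNReal.ofReal l < ∫⁻ y, k x y * ENNReal.ofReal |f y| ∂μ} ≤
      ENNReal.ofReal ((2 * A) ^ q / (q - 1) * m ^ q * l ^ (-q)) := by
  have hq' : 0 < q - 1 := by linarith
  set h : ℝ := l / (2 * A) with hh
  have hh0 : 0 < h := by positivity
  set G : α → ℝ≥0∞ := fun y => ENNReal.ofReal (|f y| - h)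
  have hG : Measurable G := by fun_prop
  have hkG : Measurable (Function.uncurry fun x y => k x y * G y) :=
    hk.mul (hG.comp measurable_snd)
  have hl2 : ENNReal.ofReal l = ENNReal.ofReal (l / 2) + ENNReal.ofReal (l / 2) := by
    rw [← ENNReal.ofReal_add (by positivity) (by positivity), add_halves]
  have hAh : ENNReal.ofReal A * ENNReal.ofReal h = ENNReal.ofReal (l / 2) := by
    rw [← ENNReal.ofReal_mul hA0.le, hh]
    congr 1
    field_simp
  have hsub : {x | ENNReal.ofReal l < ∫⁻ y, k x y * ENNReal.ofReal |f y| ∂μ} ⊆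
      {x | ENNReal.ofReal (l / 2) ≤ ∫⁻ y, k x y * G y ∂μ} := by
    intro x hx
    have := lt_of_lt_of_le hx (lintegral_mul_ofReal_abs_le hk hA h x)
    rw [hAh, hl2] at this
    exact (lt_of_add_lt_add_left this).le
  have hint : ∫⁻ x, ∫⁻ y, k x y * G y ∂μ ∂μ ≤
      ENNReal.ofReal (A * (m ^ q * h ^ (1 - q) / (q - 1))) := by
    rw [lintegral_lintegral_swap hkG.aemeasurable, ENNReal.ofReal_mul hA0.le]
    calc ∫⁻ y, ∫⁻ x, k x y * G y ∂μ ∂μ = ∫⁻ y, (∫⁻ x, k x y ∂μ) * G y ∂μ := by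
          refine lintegral_congr fun y => lintegral_mul_const _ hk.of_uncurry_right
      _ ≤ ∫⁻ y, ENNReal.ofReal A * G y ∂μ := by
          gcongr with y
          exact hA' y
      _ = ENNReal.ofReal A * ∫⁻ y, G y ∂μ := lintegral_const_mul _ hG
      _ ≤ _ := by gcongr; exact lintegral_abs_sub_le_of_meas_lt_le hf hq hm hh0 hfm
  calc _ ≤ (∫⁻ x, ∫⁻ y, k x y * G y ∂μ ∂μ) / ENNReal.ofReal (l / 2) :=
        (measure_mono hsub).trans (meas_ge_le_lintegral_div hkG.lintegral_prod_right.aemeasurable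
          (by simpa using hl) ENNReal.ofReal_ne_top)
    _ ≤ ENNReal.ofReal (A * (m ^ q * h ^ (1 - q) / (q - 1))) / ENNReal.ofReal (l / 2) := by
        gcongr
    _ = ENNReal.ofReal ((2 * A) ^ q / (q - 1) * m ^ q * l ^ (-q)) := by
        rw [← ENNReal.ofReal_div_of_pos (by positivity)]
        congr 1
        rw [hh, div_rpow hl.le (by positivity), rpow_sub hl, rpow_sub (by positivity : 0 < 2 * A),
          rpow_one, rpow_one, rpow_neg hl.le]
        field_simp

end Kernel

/-- The interpolation step: `λ (D m^q λ^{-q})^{1/r}` for `λ` below the pointwise bound. -/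
theorem mul_rpow_le_of_le {D S τ m l q r : ℝ} (hD : 0 < D) (hS : 0 < S) (hτ : 0 < τ) (hm : 0 < m)
    (hl : 0 < l) (hq : 0 < q) (hqr : q ≤ r) (hle : l ≤ S * τ ^ (1 / q) * m) :
    l * (D * m ^ q * l ^ (-q)) ^ (1 / r) ≤
      D ^ (1 / r) * S ^ (1 - q / r) * τ ^ (1 / q - 1 / r) * m := by
  have hr : 0 < r := hq.trans_le hqr
  have h1 : 0 ≤ 1 - q / r := by
    rw [sub_nonneg, div_le_one hr]
    exact hqr
  calc l * (D * m ^ q * l ^ (-q)) ^ (1 / r)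
      = D ^ (1 / r) * m ^ (q / r) * l ^ (1 - q / r) := by
        rw [mul_rpow (by positivity) (by positivity), mul_rpow (by positivity) (by positivity),
          ← rpow_mul hm.le, ← rpow_mul hl.le, rpow_sub hl, rpow_one, neg_mul, rpow_neg hl.le,
          mul_one_div]
        field_simp
    _ ≤ D ^ (1 / r) * m ^ (q / r) * (S * τ ^ (1 / q) * m) ^ (1 - q / r) := by gcongr
    _ = D ^ (1 / r) * S ^ (1 - q / r) * τ ^ (1 / q - 1 / r) * m := by
        rw [mul_rpow (by positivity) hm.le, mul_rpow hS.le (by positivity), ← rpow_mul hτ.le,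
          show 1 / q * (1 - q / r) = 1 / q - 1 / r by field_simp, rpow_sub hm, rpow_one]
        field_simp

theorem integrable_exp_neg_mul_norm_rpow {N : ℕ} (hN : 1 ≤ N) {c p : ℝ} (hc : 0 < c)
    (hp : 0 < p) : Integrable fun z : EuclideanSpace ℝ (Fin N) => Real.exp (-c * ‖z‖ ^ p) := by
  have : Nonempty (Fin N) := ⟨⟨0, hN⟩⟩
  refine (integrable_fun_norm_addHaar volume (f := fun s => Real.exp (-c * s ^ p))).2 ?_
  refine (integrableOn_rpow_mul_exp_neg_mul_rpow (s := ((N - 1 : ℕ) : ℝ))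
    (by have : (0 : ℝ) ≤ ((N - 1 : ℕ) : ℝ) := Nat.cast_nonneg _
        linarith) hp hc).congr_fun (fun s _ => ?_) measurableSet_Ioi
  simp [rpow_natCast]

/-- The Gaussian-type profile has an `L¹` norm independent of time. -/
theorem lintegral_profile {N : ℕ} (hN : 1 ≤ N) {a C c t : ℝ} (ha2 : a < 1) (hC : 0 < C)
    (hc : 0 < c) (ht : 0 < t) :
    ∫⁻ z : EuclideanSpace ℝ (Fin N), ENNReal.ofReal (C * t ^ (-(N : ℝ) / (2 - a)) *
        Real.exp (-c * (‖z‖ ^ (2 - a) / t) ^ (1 / (1 - a)))) =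
      ENNReal.ofReal (C * ∫ z : EuclideanSpace ℝ (Fin N),
        Real.exp (-c * ‖z‖ ^ ((2 - a) / (1 - a)))) := by
  have h1 : 0 < 1 - a := by linarith
  have h2 : 0 < 2 - a := by linarith
  set s : ℝ := t ^ (1 / (2 - a)) with hs
  have hs0 : 0 < s := by positivity
  have hst : s ^ (2 - a) = t := by
    rw [hs, ← rpow_mul ht.le, one_div_mul_cancel h2.ne', rpow_one]
  have hsN : t ^ (-(N : ℝ) / (2 - a)) = (s ^ N)⁻¹ := by
    rw [hs, ← rpow_natCast, ← rpow_mul ht.le, ← rpow_neg ht.le]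
    congr 1
    ring
  have hexp : ∀ z : EuclideanSpace ℝ (Fin N),
      Real.exp (-c * (‖z‖ ^ (2 - a) / t) ^ (1 / (1 - a))) =
        Real.exp (-c * ‖s⁻¹ • z‖ ^ ((2 - a) / (1 - a))) := fun z => by
    rw [norm_smul, norm_inv, norm_of_nonneg hs0.le, ← hst, ← div_rpow (norm_nonneg z) hs0.le,
      ← rpow_mul (by positivity), mul_one_div, div_eq_inv_mul]
  have hint := (integrable_exp_neg_mul_norm_rpow hN hc (div_pos h2 h1)).comp_smul
    (inv_ne_zero hs0.ne')
  simp_rw [hexp]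
  rw [← ofReal_integral_eq_lintegral_ofReal (hint.const_mul _)
    (ae_of_all _ fun z => by positivity), integral_const_mul,
    Measure.integral_comp_inv_smul_of_nonneg volume
      (fun z : EuclideanSpace ℝ (Fin N) => Real.exp (-c * ‖z‖ ^ ((2 - a) / (1 - a)))) hs0.le,
    hsN, finrank_euclideanSpace_fin, smul_eq_mul]
  congr 1
  field_simp

theorem meas_lt_abs_le_of_weakNorm_le {N : ℕ} {q m : ℝ} (hq : 0 < q) (hm : 0 < m)
    {f : EuclideanSpace ℝ (Fin N) → ℝ} (hf : weakNorm N q f ≤ ENNReal.ofReal m) {l : ℝ}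
    (hl : 0 < l) : volume {x | l < |f x|} ≤ ENNReal.ofReal (m ^ q * l ^ (-q)) := by
  have h : ENNReal.ofReal l * volume {x | l < |f x|} ^ (1 / q) ≤ ENNReal.ofReal m :=
    (le_iSup₂ (f := fun (l : ℝ) (_ : 0 < l) =>
      ENNReal.ofReal l * volume {x | l < |f x|} ^ (1 / q)) l hl).trans hf
  rw [mul_comm, ← ENNReal.le_div_iff_mul_le (by simp [hl]) (by simp),
    ← ENNReal.ofReal_div_of_pos hl, one_div, ENNReal.rpow_inv_le_iff hq,
    ENNReal.ofReal_rpow_of_pos (by positivity), div_rpow hm.le hl.le] at h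
  rwa [rpow_neg hl.le, ← div_eq_mul_inv]

/-- Property (G2): weak `L^q → L^r` smoothing estimate (`1 < q ≤ r < ∞`), for any
kernel dominated pointwise by the Gaussian-type profile. -/
theorem smoothing_weakLp
    (N : ℕ) (hN : 1 ≤ N) (a : ℝ) (ha1 : -1 < a) (ha2 : a < 1)
    (K : EuclideanSpace ℝ (Fin N) → EuclideanSpace ℝ (Fin N) → ℝ → ℝ)
    (hKmeas : Measurable (fun q :
      EuclideanSpace ℝ (Fin N) × EuclideanSpace ℝ (Fin N) × ℝ => K q.1 q.2.1 q.2.2))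
    (C₀ c₀ : ℝ) (hC₀ : 0 < C₀) (hc₀ : 0 < c₀)
    (hK : ∀ x y : EuclideanSpace ℝ (Fin N), ∀ t : ℝ, 0 < t →
      0 ≤ K x y t ∧ K x y t ≤ C₀ * t ^ (-(N : ℝ) / (2 - a)) *
        Real.exp (-c₀ * (‖x - y‖ ^ (2 - a) / t) ^ (1 / (1 - a)))) :
    ∀ q r : ℝ, 1 < q → q ≤ r →
      ∃ C : ℝ, 0 < C ∧ ∀ φ : EuclideanSpace ℝ (Fin N) → ℝ, Measurable φ →
        weakNorm N q φ ≠ ⊤ → ∀ t : ℝ, 0 < t →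
          weakNorm N r (fun x => ∫ y, K x y t * φ y) ≤
            ENNReal.ofReal (C * t ^ (-((N : ℝ) / (2 - a)) * (1 / q - 1 / r))) *
              weakNorm N q φ := by
  intro q r hq hqr
  have hq0 : 0 < q := by linarith
  have hr0 : 0 < r := hq0.trans_le hqr
  have hq1 : 0 < q - 1 := by linarith
  have h1 : 0 < 1 - a := by linarith
  have h2 : 0 < 2 - a := by linarith
  set A : ℝ := C₀ * ∫ z : EuclideanSpace ℝ (Fin N), Real.exp (-c₀ * ‖z‖ ^ ((2 - a) / (1 - a)))
    with hA
  have hA0 : 0 < A := mul_pos hC₀ <|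
    integral_exp_pos (integrable_exp_neg_mul_norm_rpow hN hc₀ (div_pos h2 h1))
  set D : ℝ := (2 * A) ^ q / (q - 1)
  have hD0 : 0 < D := by positivity
  set S : ℝ := A + C₀ / (q - 1) with hS
  have hS0 : 0 < S := by positivity
  refine ⟨D ^ (1 / r) * S ^ (1 - q / r), by positivity, fun φ hφ hφtop t ht => ?_⟩
  set τ : ℝ := t ^ (-(N : ℝ) / (2 - a)) with hτ
  have hτ0 : 0 < τ := by positivity
  have hτt : t ^ (-((N : ℝ) / (2 - a)) * (1 / q - 1 / r)) = τ ^ (1 / q - 1 / r) := by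
    rw [hτ, ← rpow_mul ht.le, neg_div]
  rw [hτt]
  set k : EuclideanSpace ℝ (Fin N) → EuclideanSpace ℝ (Fin N) → ℝ≥0∞ :=
    fun x y => ENNReal.ofReal (K x y t)
  have hk : Measurable (Function.uncurry k) :=
    (hKmeas.comp (measurable_fst.prodMk (measurable_snd.prodMk measurable_const))).ennreal_ofReal
  set g : EuclideanSpace ℝ (Fin N) → ℝ≥0∞ := fun z => ENNReal.ofReal (C₀ * τ *
    Real.exp (-c₀ * (‖z‖ ^ (2 - a) / t) ^ (1 / (1 - a))))
  have hg : ∫⁻ z, g z = ENNReal.ofReal A := lintegral_profile hN ha2 hC₀ hc₀ ht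
  have hkg : ∀ x y, k x y ≤ g (x - y) := fun x y => ENNReal.ofReal_le_ofReal (hK x y t ht).2
  have hkA : ∀ x, ∫⁻ y, k x y ≤ ENNReal.ofReal A := fun x =>
    (lintegral_mono (hkg x)).trans_eq ((lintegral_sub_left_eq_self g x).trans hg)
  have hkA' : ∀ y, ∫⁻ x, k x y ≤ ENNReal.ofReal A := fun y =>
    (lintegral_mono fun x => hkg x y).trans_eq ((lintegral_sub_right_eq_self g y).trans hg)
  have hkB : ∀ x y, k x y ≤ ENNReal.ofReal (C₀ * τ) := fun x y => by
    refine ENNReal.ofReal_le_ofReal ((hK x y t ht).2.trans ?_)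
    refine mul_le_of_le_one_right (by positivity) (Real.exp_le_one_iff.2 ?_)
    rw [neg_mul, neg_nonpos]
    positivity
  have hle : ∀ x, ENNReal.ofReal |∫ y, K x y t * φ y| ≤ ∫⁻ y, k x y * ENNReal.ofReal |φ y| :=
    fun x => by
      rw [← Real.enorm_eq_ofReal_abs]
      refine (enorm_integral_le_lintegral_enorm _).trans_eq (lintegral_congr fun y => ?_)
      rw [enorm_mul, Real.enorm_eq_ofReal (hK x y t ht).1, Real.enorm_eq_ofReal_abs]
  set P : ℝ := D ^ (1 / r) * S ^ (1 - q / r) * τ ^ (1 / q - 1 / r)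
  have hP0 : 0 < P := by positivity
  have key : ∀ m : ℝ, 0 < m → weakNorm N q φ ≤ ENNReal.ofReal m →
      weakNorm N r (fun x => ∫ y, K x y t * φ y) ≤ ENNReal.ofReal P * ENNReal.ofReal m := by
    intro m hm hφm
    have htail := fun l (hl : 0 < l) => meas_lt_abs_le_of_weakNorm_le hq0 hm hφm hl
    have hsup : ∀ x, |∫ y, K x y t * φ y| ≤ S * τ ^ (1 / q) * m := fun x => by
      have hh : 0 < τ ^ (1 / q) * m := by positivity
      have := (hle x).trans (lintegral_mul_ofReal_abs_le_of_meas_lt_le hk hA0 (mul_pos hC₀ hτ0)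
        hkA hkB hφ hq hm hh htail x)
      rw [ENNReal.ofReal_le_ofReal_iff (by positivity)] at this
      refine this.trans_eq ?_
      rw [mul_rpow (by positivity) hm.le, ← rpow_mul hτ0.le,
        show 1 / q * (1 - q) = 1 / q - 1 by field_simp, rpow_sub hτ0, rpow_sub hm, rpow_one,
        rpow_one, hS]
      field_simp
    refine iSup₂_le fun l hl => ?_
    rw [← ENNReal.ofReal_mul (by positivity)]
    rcases le_or_gt l (S * τ ^ (1 / q) * m) with hlS | hlS
    · have hmeas : volume {x | l < |∫ y, K x y t * φ y|} ≤
          ENNReal.ofReal (D * m ^ q * l ^ (-q)) := by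
        refine (measure_mono fun x (hx : l < _) => ?_).trans
          (meas_lt_lintegral_mul_ofReal_abs_le hk hA0 hkA hkA' hφ hq hm hl htail)
        exact ((ENNReal.ofReal_lt_ofReal_iff (hl.trans hx)).2 hx).trans_le (hle x)
      calc _ ≤ ENNReal.ofReal l * ENNReal.ofReal (D * m ^ q * l ^ (-q)) ^ (1 / r) := by gcongr
        _ = ENNReal.ofReal (l * (D * m ^ q * l ^ (-q)) ^ (1 / r)) := by
          rw [ENNReal.ofReal_rpow_of_pos (by positivity), ENNReal.ofReal_mul hl.le]
        _ ≤ _ := ENNReal.ofReal_le_ofReal (mul_rpow_le_of_le hD0 hS0 hτ0 hm hl hq0 hqr hlS)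
    · have : {x | l < |∫ y, K x y t * φ y|} = ∅ :=
        eq_empty_of_forall_notMem fun x (hx : l < _) => ((hsup x).trans_lt (hlS.trans hx)).false
      simp [this, hr0]
  have hdiv : weakNorm N r (fun x => ∫ y, K x y t * φ y) / ENNReal.ofReal P ≤ weakNorm N q φ := by
    refine le_of_forall_gt_imp_ge_of_dense fun b hb => ?_
    rcases eq_or_ne b ⊤ with rfl | hbtop
    · exact le_top
    · refine ENNReal.div_le_of_le_mul' ?_
      have hb' := ENNReal.ofReal_toReal hbtop
      rw [← hb']
      exact key b.toReal (ENNReal.toReal_pos (zero_le.trans_lt hb).ne' hbtop) (hb'.symm ▸ hb.le)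
  rwa [ENNReal.div_le_iff' (by simp [hP0]) (by simp)] at hdiv
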